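/- Bohm–Gross dispersion relation for the Langmuir pole (Lemma 2.5, expansion (2.13)): If p : [0,ν₀) → ℂ is a pole branch, then there exist ν₁ ∈ (0, ν₀] and C > 0 such that for all κ ∈ (0, ν₁) one has |p(κ)² + ω_p² + 3·β·κ²| ≤ C·κ⁴; in particular (Im p(κ))² = ω_p² + 3·β·κ² + O(κ⁴), the Bohm–Gross relation. -/

import Mathlib

open MeasureTheory Complex

/-- The Fourier transform of the Maxwellian along a fixed direction:
`F(s) = n₀ · exp(−β s²/2)`. -/
noncomputable def Fmax (n₀ β : ℝ) (s : ℝ) : ℝ := n₀ * Real.exp (-β * s ^ 2 / 2)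

/-- The plasma dispersion function
`𝓛(z,κ) = −(w₀/κ²) ∫₀^∞ s F(s) exp(−(z/κ) s) ds` with `w₀ = ωp²/n₀`. -/
noncomputable def disp (n₀ β ωp : ℝ) (z : ℂ) (κ : ℝ) : ℂ :=
  -(((ωp ^ 2 / n₀ : ℝ) : ℂ) / (κ : ℂ) ^ 2) *
    ∫ s in Set.Ioi (0 : ℝ),
      ((s : ℝ) : ℂ) * ((Fmax n₀ β s : ℝ) : ℂ) * Complex.exp (-(z / (κ : ℂ)) * ((s : ℝ) : ℂ))

/-- Gaussian times exponential. -/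
noncomputable def gE (β : ℝ) (ζ : ℂ) (s : ℝ) : ℂ :=
  Complex.exp ((-(β : ℂ) / 2) * (s : ℂ) ^ 2 + (-ζ) * (s : ℂ) + 0)

lemma gE_integrable (β : ℝ) (hβ : 0 < β) (ζ : ℂ) : Integrable (gE β ζ) := by
  have hb : (-(β : ℂ) / 2).re < 0 := by
    simp
    linarith
  exact integrable_cexp_quadratic' hb (-ζ) 0

lemma gE_norm (β : ℝ) (ζ : ℂ) (s : ℝ) :
    ‖gE β ζ s‖ = Real.exp (-β / 2 * s ^ 2 - ζ.re * s) := by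
  unfold gE
  rw [Complex.norm_exp]
  congr 1
  have : (-(β : ℂ) / 2) * (s : ℂ) ^ 2 = ((-β / 2 * s ^ 2 : ℝ) : ℂ) := by push_cast; ring
  rw [this]
  simp only [Complex.add_re, Complex.ofReal_re, Complex.re_mul_ofReal, Complex.neg_re,
    Complex.zero_re]
  ring

lemma gE_cont (β : ℝ) (ζ : ℂ) : Continuous (gE β ζ) := by
  unfold gE; fun_prop

lemma gE_pow_integrable (β : ℝ) (hβ : 0 < β) (ζ : ℂ) (k : ℕ) :
    Integrable (fun s : ℝ => (s : ℂ) ^ k * gE β ζ s) := by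
  have h1 := (gE_integrable β hβ (ζ - 1)).norm
  have h2 := (gE_integrable β hβ (ζ + 1)).norm
  refine ((h1.add h2).const_mul (k.factorial : ℝ)).mono' ?_ ?_
  · have := gE_cont β ζ
    exact Continuous.aestronglyMeasurable (by fun_prop)
  · refine Filter.Eventually.of_forall fun s => ?_
    simp only [Pi.add_apply]
    rw [norm_mul, gE_norm, gE_norm, gE_norm, norm_pow, Complex.norm_real, Real.norm_eq_abs]
    have hk : |s| ^ k ≤ k.factorial * Real.exp |s| := by
      have := Real.pow_div_factorial_le_exp |s| (abs_nonneg s) k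
      rw [div_le_iff₀ (by positivity)] at this
      linarith
    have he : Real.exp |s| ≤ Real.exp s + Real.exp (-s) := by
      rcases abs_cases s with ⟨h, _⟩ | ⟨h, _⟩ <;> rw [h] <;>
        linarith [Real.exp_pos s, Real.exp_pos (-s)]
    have e1 : Real.exp (-β / 2 * s ^ 2 - (ζ - 1).re * s)
        = Real.exp s * Real.exp (-β / 2 * s ^ 2 - ζ.re * s) := by
      rw [← Real.exp_add]; congr 1; simp; ring
    have e2 : Real.exp (-β / 2 * s ^ 2 - (ζ + 1).re * s)
        = Real.exp (-s) * Real.exp (-β / 2 * s ^ 2 - ζ.re * s) := by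
      rw [← Real.exp_add]; congr 1; simp; ring
    rw [e1, e2, ← add_mul, ← mul_assoc]
    gcongr
    exact hk.trans (by gcongr)

lemma gE_hasDerivAt (β : ℝ) (ζ : ℂ) (s : ℝ) :
    HasDerivAt (gE β ζ) ((-(β : ℂ) * s - ζ) * gE β ζ s) s := by
  have hs : HasDerivAt (fun s : ℝ => (s : ℂ)) 1 s := Complex.ofRealCLM.hasDerivAt
  have h := ((((hs.pow 2).const_mul (-(β : ℂ) / 2)).add (hs.const_mul (-ζ))).add_const 0).cexp
  refine h.congr_deriv ?_
  simp [gE]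
  ring

/-- sixth derivative polynomial -/
noncomputable def P6 (β : ℝ) (s : ℝ) : ℂ :=
  -105 * (β : ℂ) ^ 3 * s ^ 1 + 105 * (β : ℂ) ^ 4 * s ^ 3 - 21 * (β : ℂ) ^ 5 * s ^ 5
    + (β : ℂ) ^ 6 * s ^ 7

lemma P6_integrable (β : ℝ) (hβ : 0 < β) (ζ : ℂ) :
    Integrable (fun s : ℝ => P6 β s * gE β ζ s) := by
  have h := fun k => gE_pow_integrable β hβ ζ k
  refine (((((h 1).const_mul (-105 * (β : ℂ) ^ 3)).add ((h 3).const_mul (105 * (β : ℂ) ^ 4))).sub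
    ((h 5).const_mul (21 * (β : ℂ) ^ 5))).add ((h 7).const_mul ((β : ℂ) ^ 6))).congr ?_
  refine Filter.Eventually.of_forall fun s => ?_
  simp [P6]
  ring

/-- polynomial of the antiderivative -/
noncomputable def Q (β : ℝ) (ζ : ℂ) (s : ℝ) : ℂ :=
  -((s : ℂ) / ζ + (1 - β * (s : ℂ) ^ 2) / ζ ^ 2 + (-3 * β * s + (β : ℂ) ^ 2 * (s : ℂ) ^ 3) / ζ ^ 3
    + (-3 * β + 6 * (β : ℂ) ^ 2 * (s : ℂ) ^ 2 - (β : ℂ) ^ 3 * (s : ℂ) ^ 4) / ζ ^ 4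
    + (15 * (β : ℂ) ^ 2 * s - 10 * (β : ℂ) ^ 3 * (s : ℂ) ^ 3 + (β : ℂ) ^ 4 * (s : ℂ) ^ 5) / ζ ^ 5
    + (15 * (β : ℂ) ^ 2 - 45 * (β : ℂ) ^ 3 * (s : ℂ) ^ 2 + 15 * (β : ℂ) ^ 4 * (s : ℂ) ^ 4
      - (β : ℂ) ^ 5 * (s : ℂ) ^ 6) / ζ ^ 6)

lemma Q_integrable (β : ℝ) (hβ : 0 < β) (ζ : ℂ) :
    Integrable (fun s : ℝ => Q β ζ s * gE β ζ s) := by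
  have h := fun (c : ℂ) k => (gE_pow_integrable β hβ ζ k).const_mul c
  refine (((((((h (-(1 / ζ ^ 2 + -3 * β / ζ ^ 4 + 15 * (β : ℂ) ^ 2 / ζ ^ 6)) 0).add
    (h (-(1 / ζ - 3 * β / ζ ^ 3 + 15 * (β : ℂ) ^ 2 / ζ ^ 5)) 1)).add
    (h (β / ζ ^ 2 - 6 * (β : ℂ) ^ 2 / ζ ^ 4 + 45 * (β : ℂ) ^ 3 / ζ ^ 6) 2)).add
    (h (-((β : ℂ) ^ 2 / ζ ^ 3) + 10 * (β : ℂ) ^ 3 / ζ ^ 5) 3)).add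
    (h ((β : ℂ) ^ 3 / ζ ^ 4 - 15 * (β : ℂ) ^ 4 / ζ ^ 6) 4)).add
    (h (-((β : ℂ) ^ 4 / ζ ^ 5)) 5)).add
    (h ((β : ℂ) ^ 5 / ζ ^ 6) 6)).congr ?_
  refine Filter.Eventually.of_forall fun s => ?_
  simp [Q]
  ring

lemma Q_hasDerivAt (β : ℝ) (ζ : ℂ) (hζ : ζ ≠ 0) (s : ℝ) :
    HasDerivAt (fun s : ℝ => Q β ζ s * gE β ζ s)
      ((s : ℂ) ^ 1 * gE β ζ s - 1 / ζ ^ 6 * (P6 β s * gE β ζ s)) s := by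
  have hs : HasDerivAt (fun s : ℝ => (s : ℂ)) 1 s := Complex.ofRealCLM.hasDerivAt
  have hQ : HasDerivAt (Q β ζ) (-(1 / ζ + (-2 * β * s) / ζ ^ 2
      + (-3 * β + 3 * (β : ℂ) ^ 2 * (s : ℂ) ^ 2) / ζ ^ 3
      + (12 * (β : ℂ) ^ 2 * (s : ℂ) - 4 * (β : ℂ) ^ 3 * (s : ℂ) ^ 3) / ζ ^ 4
      + (15 * (β : ℂ) ^ 2 - 30 * (β : ℂ) ^ 3 * (s : ℂ) ^ 2 + 5 * (β : ℂ) ^ 4 * (s : ℂ) ^ 4) / ζ ^ 5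
      + (- 90 * (β : ℂ) ^ 3 * (s : ℂ) + 60 * (β : ℂ) ^ 4 * (s : ℂ) ^ 3
      - 6 * (β : ℂ) ^ 5 * (s : ℂ) ^ 5) / ζ ^ 6)) s := by
    have t0 := hs.div_const ζ
    have t1 := (((hs.pow 2).const_mul (β : ℂ)).const_sub 1).div_const (ζ ^ 2)
    have t2 := ((hs.const_mul (-3 * (β : ℂ))).add
      ((hs.pow 3).const_mul ((β : ℂ) ^ 2))).div_const (ζ ^ 3)
    have t3 := ((((hs.pow 2).const_mul (6 * (β : ℂ) ^ 2)).const_add (-3 * (β : ℂ))).sub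
      ((hs.pow 4).const_mul ((β : ℂ) ^ 3))).div_const (ζ ^ 4)
    have t4 := (((hs.const_mul (15 * (β : ℂ) ^ 2)).sub
      ((hs.pow 3).const_mul (10 * (β : ℂ) ^ 3))).add
      ((hs.pow 5).const_mul ((β : ℂ) ^ 4))).div_const (ζ ^ 5)
    have t5 := (((((hs.pow 2).const_mul (45 * (β : ℂ) ^ 3)).const_sub (15 * (β : ℂ) ^ 2)).add
      ((hs.pow 4).const_mul (15 * (β : ℂ) ^ 4))).sub
      ((hs.pow 6).const_mul ((β : ℂ) ^ 5))).div_const (ζ ^ 6)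
    have t := (((((t0.add t1).add t2).add t3).add t4).add t5).neg
    refine t.congr_deriv ?_
    simp
    ring
  refine (hQ.mul (gE_hasDerivAt β ζ s)).congr_deriv ?_
  simp only [Q, P6]
  field_simp
  ring

lemma half_expansion (β : ℝ) (hβ : 0 < β) (ζ : ℂ) (hζ : ζ ≠ 0) :
    ∫ s in Set.Ioi (0 : ℝ), (s : ℂ) ^ 1 * gE β ζ s
      = 1 / ζ ^ 2 - 3 * β / ζ ^ 4 + 15 * (β : ℂ) ^ 2 / ζ ^ 6
        + 1 / ζ ^ 6 * ∫ s in Set.Ioi (0 : ℝ), P6 β s * gE β ζ s := by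
  have hd := Q_hasDerivAt β ζ hζ
  have i1 := (gE_pow_integrable β hβ ζ 1).integrableOn (s := Set.Ioi (0 : ℝ))
  have i2 := ((P6_integrable β hβ ζ).const_mul (1 / ζ ^ 6)).integrableOn (s := Set.Ioi (0 : ℝ))
  have i3 := (Q_integrable β hβ ζ).integrableOn (s := Set.Ioi (0 : ℝ))
  have ht := tendsto_zero_of_hasDerivAt_of_integrableOn_Ioi (a := (0 : ℝ))
    (fun s _ => hd s) (i1.sub i2) i3
  have h := integral_Ioi_of_hasDerivAt_of_tendsto' (a := (0 : ℝ)) (fun s _ => hd s) (i1.sub i2) ht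
  rw [integral_sub i1 i2, integral_const_mul] at h
  rw [sub_eq_iff_eq_add.mp h]
  simp [Q, gE]
  ring

lemma half_bound (β : ℝ) (hβ : 0 < β) :
    ∃ M > (0 : ℝ), ∀ ζ : ℂ, ζ ≠ 0 → 0 ≤ ζ.re →
      ‖(∫ s in Set.Ioi (0 : ℝ), (s : ℂ) ^ 1 * gE β ζ s) - (1 / ζ ^ 2 - 3 * β / ζ ^ 4)‖
        ≤ M / ‖ζ‖ ^ 6 := by
  refine ⟨15 * β ^ 2 + ∫ s in Set.Ioi (0 : ℝ), ‖P6 β s * gE β 0 s‖, ?_, ?_⟩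
  · have : 0 ≤ ∫ s in Set.Ioi (0 : ℝ), ‖P6 β s * gE β 0 s‖ :=
      integral_nonneg fun _ => norm_nonneg _
    positivity
  · intro ζ hζ hre
    rw [half_expansion β hβ ζ hζ]
    have hb : ‖∫ s in Set.Ioi (0 : ℝ), P6 β s * gE β ζ s‖
        ≤ ∫ s in Set.Ioi (0 : ℝ), ‖P6 β s * gE β 0 s‖ := by
      refine norm_integral_le_of_norm_le (P6_integrable β hβ 0).norm.integrableOn ?_
      refine (ae_restrict_iff' measurableSet_Ioi).2 (Filter.Eventually.of_forall fun s hs => ?_)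
      rw [norm_mul, norm_mul, gE_norm, gE_norm]
      have := mul_nonneg hre (le_of_lt hs)
      refine mul_le_mul_of_nonneg_left (Real.exp_le_exp.2 ?_) (norm_nonneg _)
      simpa using this
    have e : ∀ J : ℂ, 1 / ζ ^ 2 - 3 * β / ζ ^ 4 + 15 * (β : ℂ) ^ 2 / ζ ^ 6
        + 1 / ζ ^ 6 * J - (1 / ζ ^ 2 - 3 * β / ζ ^ 4) = (15 * (β : ℂ) ^ 2 + J) / ζ ^ 6 := by
      intro J; ring
    rw [e, norm_div, norm_pow]
    gcongr
    refine (norm_add_le _ _).trans (add_le_add ?_ hb)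
    simp

lemma gE_reflect (β : ℝ) (hβ : 0 < β) (ζ : ℂ) :
    ∫ s in Set.Ioi (0 : ℝ), (s : ℂ) ^ 1 * gE β ζ s
      = (∫ s in Set.Ioi (0 : ℝ), (s : ℂ) ^ 1 * gE β (-ζ) s) + ∫ s : ℝ, (s : ℂ) ^ 1 * gE β ζ s := by
  have i := gE_pow_integrable β hβ ζ 1
  rw [← intervalIntegral.integral_Iic_add_Ioi (b := (0 : ℝ)) i.integrableOn i.integrableOn]
  have h := integral_comp_neg_Ioi (0 : ℝ) (fun s : ℝ => (s : ℂ) ^ 1 * gE β ζ s)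
  rw [neg_zero] at h
  rw [← h, ← add_assoc, ← integral_add]
  · simp [gE]
  · exact (gE_pow_integrable β hβ (-ζ) 1).integrableOn
  · exact i.comp_neg.integrableOn

lemma gE_moment (β : ℝ) (hβ : 0 < β) (ζ : ℂ) :
    ∫ s : ℝ, (s : ℂ) ^ 1 * gE β ζ s = -(ζ / β) * ∫ s : ℝ, gE β ζ s := by
  have i1 := (gE_pow_integrable β hβ ζ 1).const_mul (-(β : ℂ))
  have i0 := (gE_integrable β hβ ζ).const_mul ζ
  have h := integral_eq_zero_of_hasDerivAt_of_integrable (f := gE β ζ)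
    (f' := fun s : ℝ => -(β : ℂ) * ((s : ℂ) ^ 1 * gE β ζ s) - ζ * gE β ζ s)
    (fun s => (gE_hasDerivAt β ζ s).congr_deriv (by ring)) (i1.sub i0) (gE_integrable β hβ ζ)
  rw [integral_sub i1 i0, integral_const_mul, integral_const_mul] at h
  have hb : (β : ℂ) ≠ 0 := by exact_mod_cast hβ.ne'
  generalize (∫ s : ℝ, (s : ℂ) ^ 1 * gE β ζ s) = X at *
  field_simp
  linear_combination -h

lemma gE_moment_bound (β : ℝ) (hβ : 0 < β) :
    ∃ K > (0 : ℝ), ∀ ζ : ℂ, ζ ≠ 0 → (ζ ^ 2).re ≤ -‖ζ‖ ^ 2 / 4 →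
      ‖∫ s : ℝ, (s : ℂ) ^ 1 * gE β ζ s‖ ≤ K / ‖ζ‖ ^ 6 := by
  set A : ℝ := ‖((Real.pi : ℂ) / -(-(β : ℂ) / 2)) ^ (1 / 2 : ℂ)‖ with hA
  have hA0 : 0 ≤ A := norm_nonneg _
  refine ⟨(A + 1) / β * (Nat.factorial 7 * Real.exp (2 * β)), by positivity, ?_⟩
  intro ζ hζ hre
  have hI : ∫ s : ℝ, gE β ζ s = ((Real.pi : ℂ) / -(-(β : ℂ) / 2)) ^ (1 / 2 : ℂ)
      * Complex.exp (0 - (-ζ) ^ 2 / (4 * (-(β : ℂ) / 2))) := by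
    unfold gE
    apply integral_cexp_quadratic
    simp
    linarith
  have hb : (β : ℂ) ≠ 0 := by exact_mod_cast hβ.ne'
  have e : (0 - (-ζ) ^ 2 / (4 * (-(β : ℂ) / 2))) = ((1 / (2 * β) : ℝ) : ℂ) * ζ ^ 2 := by
    push_cast; field_simp; ring
  rw [gE_moment β hβ, hI, e, norm_mul, norm_mul, ← hA, Complex.norm_exp, Complex.re_ofReal_mul,
    norm_neg, norm_div, Complex.norm_real, Real.norm_of_nonneg hβ.le]
  have hz : 0 < ‖ζ‖ := norm_pos_iff.2 hζ
  have h7 : ‖ζ‖ ^ 7 ≤ Nat.factorial 7 * Real.exp ‖ζ‖ := by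
    have := Real.pow_div_factorial_le_exp ‖ζ‖ hz.le 7
    rw [div_le_iff₀ (by positivity)] at this
    linarith
  have hexp : ‖ζ‖ + 1 / (2 * β) * (ζ ^ 2).re ≤ 2 * β := by
    have h1 : 1 / (2 * β) * (ζ ^ 2).re ≤ 1 / (2 * β) * (-‖ζ‖ ^ 2 / 4) := by gcongr
    have h2 : 2 * β - ‖ζ‖ - 1 / (2 * β) * (-‖ζ‖ ^ 2 / 4) = (‖ζ‖ - 4 * β) ^ 2 / (8 * β) := by
      field_simp; ring
    have h3 : 0 ≤ (‖ζ‖ - 4 * β) ^ 2 / (8 * β) := by positivity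
    linarith
  rw [le_div_iff₀ (by positivity)]
  calc ‖ζ‖ / β * (A * Real.exp (1 / (2 * β) * (ζ ^ 2).re)) * ‖ζ‖ ^ 6
      = A / β * (‖ζ‖ ^ 7 * Real.exp (1 / (2 * β) * (ζ ^ 2).re)) := by ring
    _ ≤ (A + 1) / β * ((Nat.factorial 7 * Real.exp ‖ζ‖) * Real.exp (1 / (2 * β) * (ζ ^ 2).re)) := by
        gcongr; linarith
    _ = (A + 1) / β * (Nat.factorial 7 * Real.exp (‖ζ‖ + 1 / (2 * β) * (ζ ^ 2).re)) := by
        rw [Real.exp_add]; ring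
    _ ≤ _ := by gcongr

lemma full_bound (β : ℝ) (hβ : 0 < β) :
    ∃ M > (0 : ℝ), ∀ ζ : ℂ, ζ ≠ 0 → (ζ ^ 2).re ≤ -‖ζ‖ ^ 2 / 4 →
      ‖(∫ s in Set.Ioi (0 : ℝ), (s : ℂ) ^ 1 * gE β ζ s) - (1 / ζ ^ 2 - 3 * β / ζ ^ 4)‖
        ≤ M / ‖ζ‖ ^ 6 := by
  obtain ⟨M, hM, h1⟩ := half_bound β hβ
  obtain ⟨K, hK, h2⟩ := gE_moment_bound β hβ
  refine ⟨M + K, by positivity, fun ζ hζ hre => ?_⟩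
  have hz : 0 < ‖ζ‖ := norm_pos_iff.2 hζ
  rcases le_total 0 ζ.re with h | h
  · refine (h1 ζ hζ h).trans ?_
    gcongr
    linarith
  · rw [gE_reflect β hβ]
    have a := h1 (-ζ) (neg_ne_zero.2 hζ) (by simpa using h)
    have b := h2 ζ hζ hre
    rw [norm_neg, (by decide : Even 2).neg_pow, (by decide : Even 4).neg_pow] at a
    rw [add_sub_right_comm, add_div]
    exact (norm_add_le _ _).trans (add_le_add a b)

lemma disp_eq (n₀ β ωp : ℝ) (hn : 0 < n₀) (z : ℂ) (κ : ℝ) :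
    disp n₀ β ωp z κ = -((ωp : ℂ) ^ 2 / (κ : ℂ) ^ 2)
      * ∫ s in Set.Ioi (0 : ℝ), (s : ℂ) ^ 1 * gE β (z / κ) s := by
  unfold disp
  have hn' : (n₀ : ℂ) ≠ 0 := by exact_mod_cast hn.ne'
  have : ∀ s : ℝ, ((s : ℝ) : ℂ) * ((Fmax n₀ β s : ℝ) : ℂ)
      * Complex.exp (-(z / (κ : ℂ)) * ((s : ℝ) : ℂ)) = n₀ * ((s : ℂ) ^ 1 * gE β (z / κ) s) := by
    intro s
    unfold Fmax gE
    rw [add_zero, Complex.exp_add]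
    push_cast
    rw [show -(β : ℂ) * (s : ℂ) ^ 2 / 2 = -(β : ℂ) / 2 * (s : ℂ) ^ 2 by ring]
    ring
  simp_rw [this]
  rw [integral_const_mul]
  push_cast
  field_simp

/-- **Bohm–Gross dispersion relation for the Langmuir pole**
(Lemma 2.5, expansion (2.13)). -/
theorem bohm_gross_expansion_of_pole_branch
    (n₀ β ωp : ℝ) (hn : 0 < n₀) (hβ : 0 < β) (hω : 0 < ωp)
    (ν₀ : ℝ) (hν₀ : 0 < ν₀) (p : ℝ → ℂ)
    (hpc : ContinuousOn p (Set.Ico 0 ν₀))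
    (hp0 : p 0 = Complex.I * (ωp : ℂ))
    (hpole : ∀ κ ∈ Set.Ioo (0:ℝ) ν₀, disp n₀ β ωp (p κ) κ = 1) :
    ∃ ν₁ ∈ Set.Ioc (0:ℝ) ν₀, ∃ C > (0:ℝ), ∀ κ ∈ Set.Ioo (0:ℝ) ν₁,
      ‖(p κ) ^ 2 + ((ωp ^ 2 : ℝ) : ℂ) + ((3 * β * κ ^ 2 : ℝ) : ℂ)‖ ≤ C * κ ^ 4 := by
  obtain ⟨M, hM, hb⟩ := full_bound β hβ
  have hc : ContinuousWithinAt p (Set.Ico 0 ν₀) 0 := hpc 0 ⟨le_rfl, hν₀⟩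
  have hT := hc.tendsto
  rw [hp0] at hT
  have hopen : IsOpen {z : ℂ | ωp / 2 < ‖z‖ ∧ (z ^ 2).re < -‖z‖ ^ 2 / 4} := by
    apply IsOpen.inter
    · exact isOpen_lt (f := fun _ : ℂ => ωp / 2) (g := fun z : ℂ => ‖z‖) (by fun_prop) (by fun_prop)
    · exact isOpen_lt (f := fun z : ℂ => (z ^ 2).re) (g := fun z : ℂ => -‖z‖ ^ 2 / 4)
        (Complex.continuous_re.comp (by fun_prop)) (by fun_prop)
  have hmem : Complex.I * (ωp : ℂ) ∈ {z : ℂ | ωp / 2 < ‖z‖ ∧ (z ^ 2).re < -‖z‖ ^ 2 / 4} := by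
    have h1 : ‖Complex.I * (ωp : ℂ)‖ = ωp := by simp [abs_of_pos hω]
    have h2 : ((Complex.I * (ωp : ℂ)) ^ 2).re = - ωp ^ 2 := by
      rw [mul_pow, Complex.I_sq, ← Complex.ofReal_pow]; simp [-Complex.ofReal_pow]
    constructor
    · rw [h1]; linarith
    · rw [h1, h2]; nlinarith [sq_pos_of_pos hω]
  have hev := hT.eventually (hopen.mem_nhds hmem)
  rw [eventually_nhdsWithin_iff, Metric.eventually_nhds_iff] at hev
  obtain ⟨δ, hδ, hev⟩ := hev
  set D : ℝ := 16 * M / ωp ^ 2 + 12 * β with hD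
  have hD0 : 0 < D := by positivity
  refine ⟨min (min δ 1) ν₀, ⟨by positivity, min_le_right _ _⟩,
    16 * M / ωp ^ 2 + 12 * β / ωp ^ 2 * D, by positivity, ?_⟩
  rintro κ ⟨hκ0, hκ⟩
  have hκδ : κ < δ := hκ.trans_le ((min_le_left _ _).trans (min_le_left _ _))
  have hκ1 : κ < 1 := hκ.trans_le ((min_le_left _ _).trans (min_le_right _ _))
  have hκν : κ < ν₀ := hκ.trans_le (min_le_right _ _)
  obtain ⟨hp1, hp2⟩ := hev (y := κ) (by simpa [abs_of_pos hκ0] using hκδ) ⟨hκ0.le, hκν⟩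
  have hpn := hpole κ ⟨hκ0, hκν⟩
  rw [disp_eq n₀ β ωp hn] at hpn
  generalize p κ = z at *
  have hz : 0 < ‖z‖ := by linarith
  have hz0 : z ≠ 0 := norm_pos_iff.1 hz
  have hκc : (κ : ℂ) ≠ 0 := by exact_mod_cast hκ0.ne'
  have hωc : (ωp : ℂ) ≠ 0 := by exact_mod_cast hω.ne'
  have hnorm : ‖z / (κ : ℂ)‖ = ‖z‖ / κ := by
    rw [norm_div, Complex.norm_real, Real.norm_of_nonneg hκ0.le]
  have hB := hb (z / κ) (div_ne_zero hz0 hκc) (by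
    rw [hnorm, div_pow, div_pow, ← Complex.ofReal_pow, Complex.div_ofReal_re]
    have := div_le_div_of_nonneg_right hp2.le (sq_nonneg κ)
    refine this.trans (le_of_eq ?_)
    ring)
  rw [hnorm] at hB
  generalize (∫ s in Set.Ioi (0 : ℝ), (s : ℂ) ^ 1 * gE β (z / κ) s) = J at hpn hB
  have hJ : J = -((κ : ℂ) ^ 2 / (ωp : ℂ) ^ 2) := by
    field_simp at hpn ⊢
    linear_combination -hpn
  have e1 : z ^ 2 + (ωp : ℂ) ^ 2 - 3 * β * ωp ^ 2 * κ ^ 2 / z ^ 2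
      = -(z ^ 2 * ωp ^ 2 / κ ^ 2) * (J - (1 / (z / κ) ^ 2 - 3 * β / (z / κ) ^ 4)) := by
    rw [hJ]; field_simp; ring
  have b1 : ‖z ^ 2 + (ωp : ℂ) ^ 2 - 3 * β * ωp ^ 2 * κ ^ 2 / z ^ 2‖
      ≤ 16 * M / ωp ^ 2 * κ ^ 4 := by
    rw [e1, norm_mul]
    have : ‖-(z ^ 2 * (ωp : ℂ) ^ 2 / (κ : ℂ) ^ 2)‖ = ‖z‖ ^ 2 * ωp ^ 2 / κ ^ 2 := by
      simp
    rw [this]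
    calc _ ≤ ‖z‖ ^ 2 * ωp ^ 2 / κ ^ 2 * (M / (‖z‖ / κ) ^ 6) := by gcongr
      _ = M * ωp ^ 2 * κ ^ 4 / ‖z‖ ^ 4 := by field_simp
      _ ≤ M * ωp ^ 2 * κ ^ 4 / (ωp / 2) ^ 4 := by gcongr
      _ = _ := by field_simp; ring
  have b2 : 1 / ‖z‖ ^ 2 ≤ 4 / ωp ^ 2 := by
    calc 1 / ‖z‖ ^ 2 ≤ 1 / (ωp / 2) ^ 2 := by gcongr
      _ = _ := by field_simp; ring
  have b3 : ‖z ^ 2 + (ωp : ℂ) ^ 2‖ ≤ D * κ ^ 2 := by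
    have hs : z ^ 2 + (ωp : ℂ) ^ 2 = (z ^ 2 + (ωp : ℂ) ^ 2 - 3 * β * ωp ^ 2 * κ ^ 2 / z ^ 2)
        + 3 * β * ωp ^ 2 * κ ^ 2 / z ^ 2 := by ring
    have hn2 : ‖3 * (β : ℂ) * ωp ^ 2 * κ ^ 2 / z ^ 2‖ = 3 * β * ωp ^ 2 * κ ^ 2 * (1 / ‖z‖ ^ 2) := by
      simp [abs_of_pos hβ]; ring
    rw [hs]
    refine (norm_add_le _ _).trans ?_
    rw [hn2]
    have h4 : κ ^ 4 ≤ κ ^ 2 := pow_le_pow_of_le_one hκ0.le hκ1.le (by norm_num)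
    calc _ ≤ 16 * M / ωp ^ 2 * κ ^ 2 + 3 * β * ωp ^ 2 * κ ^ 2 * (4 / ωp ^ 2) := by
            gcongr
            exact b1.trans (by gcongr)
      _ = _ := by rw [hD]; field_simp; ring
  have e2 : z ^ 2 + ((ωp ^ 2 : ℝ) : ℂ) + ((3 * β * κ ^ 2 : ℝ) : ℂ)
      = (z ^ 2 + (ωp : ℂ) ^ 2 - 3 * β * ωp ^ 2 * κ ^ 2 / z ^ 2)
        + 3 * β * κ ^ 2 / z ^ 2 * (z ^ 2 + (ωp : ℂ) ^ 2) := by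
    push_cast; field_simp; ring
  rw [e2]
  refine (norm_add_le _ _).trans ?_
  rw [norm_mul]
  have hn3 : ‖3 * (β : ℂ) * κ ^ 2 / z ^ 2‖ = 3 * β * κ ^ 2 * (1 / ‖z‖ ^ 2) := by
    simp [abs_of_pos hβ]; ring
  rw [hn3]
  calc _ ≤ 16 * M / ωp ^ 2 * κ ^ 4 + 3 * β * κ ^ 2 * (4 / ωp ^ 2) * (D * κ ^ 2) := by gcongr
    _ = _ := by ring
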